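/- The BV curve tracking problem admits a solution: the infimum over μ ∈ 𝒜 of 𝓕(K(μ)) + 𝓡_{α,β}(μ) is attained by some μ ∈ 𝒜. -/

import Mathlib

open MeasureTheory Filter Topology Set
open scoped ENNReal NNReal RealInnerProductSpace

noncomputable section

/-- The unit time interval `[0,1] ⊆ ℝ`. -/
def unitI : Set ℝ := Set.Icc 0 1

/-- Lebesgue measure restricted to the unit interval. -/
def lebI : Measure ℝ := volume.restrict unitI

/-- The (pointwise) variation of a curve `f : ℝ → X` on a set `s ⊆ ℝ`,
with respect to a distance function `d`. -/
def varOn {X : Type*} (d : X → X → ℝ≥0∞) (f : ℝ → X) (s : Set ℝ) : ℝ≥0∞ :=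
  ⨆ p : ℕ × { u : ℕ → ℝ // Monotone u ∧ ∀ i, u i ∈ s },
    ∑ i ∈ Finset.range p.1, d (f (p.2.1 (i + 1))) (f (p.2.1 i))

/-- The essential variation of `f` on `s`: infimum of variations over a.e. representatives. -/
def essVarOn {X : Type*} (d : X → X → ℝ≥0∞) (f : ℝ → X) (s : Set ℝ) : ℝ≥0∞ :=
  ⨅ g ∈ {g : ℝ → X | ∀ᵐ t ∂(volume.restrict s), g t = f t}, varOn d g s

/-- Essential variation on the unit interval. -/
def essVar {X : Type*} (d : X → X → ℝ≥0∞) (f : ℝ → X) : ℝ≥0∞ := essVarOn d f unitI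

/-- Couplings (transport plans) between two measures. -/
def IsCoupling {X : Type*} [MeasurableSpace X] (ρp ρm : Measure X)
    (π : Measure (X × X)) : Prop :=
  π.map Prod.fst = ρp ∧ π.map Prod.snd = ρm

/-- The Wasserstein-1 distance between measures. -/
def W1 {X : Type*} [MeasurableSpace X] [PseudoEMetricSpace X]
    (ρp ρm : Measure X) : ℝ≥0∞ :=
  ⨅ π ∈ {π : Measure (X × X) | IsCoupling ρp ρm π}, ∫⁻ q, edist q.1 q.2 ∂π

/-- `W1` as a distance function on measures. -/
def W1M {X : Type*} [MeasurableSpace X] [PseudoEMetricSpace X] :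
    Measure X → Measure X → ℝ≥0∞ := fun a b => W1 a b

/-- Wasserstein-1 distance on probability measures. -/
def W1P {X : Type*} [MeasurableSpace X] [PseudoEMetricSpace X] :
    ProbabilityMeasure X → ProbabilityMeasure X → ℝ≥0∞ :=
  fun a b => W1 (a : Measure X) (b : Measure X)

/-- The admissible set `𝒜 = ℝ₊ ⬝ BV(I; 𝒲₁(Ω))` of weighted BV curves of probability measures. -/
def Adm {n : ℕ} (Ω : Set (EuclideanSpace ℝ (Fin n))) : Set (ℝ → Measure ↥Ω) :=
  {μ | ∃ (c : ℝ≥0) (ρ : ℝ → ProbabilityMeasure ↥Ω),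
      essVar W1P ρ < ⊤ ∧ ∀ t, μ t = (c : ℝ≥0∞) • (ρ t : Measure ↥Ω)}

/-- The weight `ω(μ)` of an admissible curve. -/
def wt {n : ℕ} {Ω : Set (EuclideanSpace ℝ (Fin n))} (μ : ℝ → Measure ↥Ω) : ℝ :=
  (μ 0 Set.univ).toReal

/-- The regularizer `𝓡_{α,β}(μ) = α ω(μ) + β essvar(μ)`. -/
def Reg {n : ℕ} {Ω : Set (EuclideanSpace ℝ (Fin n))} (α β : ℝ)
    (μ : ℝ → Measure ↥Ω) : ℝ :=
  α * wt μ + β * (essVar W1M μ).toReal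

/-- Weak-* convergence of a sequence of measures (tested against continuous functions). -/
def WStarTendsto {X : Type*} [MeasurableSpace X] [TopologicalSpace X]
    (μs : ℕ → Measure X) (μ : Measure X) : Prop :=
  ∀ φ : C(X, ℝ), Tendsto (fun j => ∫ x, φ x ∂(μs j)) atTop (𝓝 (∫ x, φ x ∂μ))

/-- A.e. (in time) weak-* convergence of curves of measures. -/
def AEWStar {n : ℕ} {Ω : Set (EuclideanSpace ℝ (Fin n))}
    (μs : ℕ → (ℝ → Measure ↥Ω)) (μ : ℝ → Measure ↥Ω) : Prop :=
  ∀ᵐ t ∂lebI, WStarTendsto (fun j => μs j t) (μ t)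

/-- Weak convergence in a real inner product space. -/
def WeakTendsto {Y : Type*} [NormedAddCommGroup Y] [InnerProductSpace ℝ Y]
    (ys : ℕ → Y) (y : Y) : Prop :=
  ∀ z : Y, Tendsto (fun j => @inner ℝ Y _ (ys j) z) atTop (𝓝 (@inner ℝ Y _ y z))

section Wasserstein

variable {X : Type*} [MeasurableSpace X]

lemma W1_smul_le [PseudoEMetricSpace X] {c : ℝ≥0∞} (hc : c ≠ ⊤) (a b : Measure X) :
    W1 (c • a) (c • b) ≤ c * W1 a b := by
  rcases eq_or_ne c 0 with rfl | hc0
  · refine (iInf₂_le (0 : Measure (X × X)) ?_).trans ?_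
    · simp [IsCoupling]
    · simp
  · rw [← ENNReal.inv_mul_le_iff hc0 hc]
    refine le_iInf₂ fun π hπ => ?_
    rw [ENNReal.inv_mul_le_iff hc0 hc, ← smul_eq_mul, ← lintegral_smul_measure]
    refine iInf₂_le (c • π) ⟨?_, ?_⟩
    · rw [Measure.map_smul, hπ.1]
    · rw [Measure.map_smul, hπ.2]

lemma measure_univ_eq_of_W1_ne_top [PseudoEMetricSpace X] {a b : Measure X}
    (h : W1 a b ≠ ⊤) : a univ = b univ := by
  obtain ⟨π, hπ⟩ : ∃ π, IsCoupling a b π := by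
    by_contra! hne
    exact h (iInf₂_eq_top.2 fun π hπ => (hne π hπ).elim)
  rw [← hπ.1, ← hπ.2, Measure.map_apply measurable_fst .univ,
    Measure.map_apply measurable_snd .univ, preimage_univ, preimage_univ]

lemma exists_coupling_lintegral_le [PseudoEMetricSpace X] (a b : ProbabilityMeasure X)
    {ε : ℝ≥0∞} (hε : ε ≠ 0) :
    ∃ π : ProbabilityMeasure (X × X), IsCoupling (a : Measure X) b π ∧
      ∫⁻ q, edist q.1 q.2 ∂(π : Measure (X × X)) ≤ W1P a b + ε := by
  have key : ∃ π : Measure (X × X), IsCoupling (a : Measure X) b π ∧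
      ∫⁻ q, edist q.1 q.2 ∂π ≤ W1P a b + ε := by
    rcases eq_or_ne (W1P a b) ⊤ with h | h
    · exact ⟨(a : Measure X).prod b, by simp [IsCoupling], by simp [h]⟩
    · have hlt := ENNReal.lt_add_right h hε
      conv_lhs at hlt => unfold W1P W1
      simp only [iInf_lt_iff] at hlt
      obtain ⟨π, hπ, hlt⟩ := hlt
      exact ⟨π, hπ, hlt.le⟩
  obtain ⟨π, hπ, hle⟩ := key
  refine ⟨⟨π, ⟨?_⟩⟩, hπ, hle⟩
  have : π.map Prod.fst univ = 1 := by rw [hπ.1]; simp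
  rwa [Measure.map_apply measurable_fst .univ, preimage_univ] at this

lemma edist_integral_le_W1P [MetricSpace X] [BorelSpace X] [CompactSpace X] {f : X → ℝ}
    {L : ℝ≥0} (hf : LipschitzWith L f) (a b : ProbabilityMeasure X) :
    edist (∫ x, f x ∂(a : Measure X)) (∫ x, f x ∂(b : Measure X)) ≤ L * W1P a b := by
  refine ENNReal.le_of_forall_pos_le_add fun ε hε _ => ?_
  obtain ⟨π, hπ, hle⟩ := exists_coupling_lintegral_le a b
    (ε := ε / (L + 1)) (by simp [hε.ne', ENNReal.div_eq_zero_iff])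
  have hfst : Integrable (fun q : X × X => f q.1) (π : Measure (X × X)) :=
    (hf.continuous.comp continuous_fst).integrable_of_hasCompactSupport
      (HasCompactSupport.of_compactSpace _)
  have hsnd : Integrable (fun q : X × X => f q.2) (π : Measure (X × X)) :=
    (hf.continuous.comp continuous_snd).integrable_of_hasCompactSupport
      (HasCompactSupport.of_compactSpace _)
  rw [← hπ.1, ← hπ.2,
    integral_map measurable_fst.aemeasurable hf.continuous.aestronglyMeasurable,
    integral_map measurable_snd.aemeasurable hf.continuous.aestronglyMeasurable,
    edist_eq_enorm_sub, ← integral_sub hfst hsnd]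
  calc ‖∫ q, (f q.1 - f q.2) ∂(π : Measure (X × X))‖ₑ
      ≤ ∫⁻ q, ‖f q.1 - f q.2‖ₑ ∂(π : Measure (X × X)) := enorm_integral_le_lintegral_enorm _
    _ ≤ ∫⁻ q, L * edist q.1 q.2 ∂(π : Measure (X × X)) :=
        lintegral_mono fun q => by rw [← edist_eq_enorm_sub]; exact hf q.1 q.2
    _ = L * ∫⁻ q, edist q.1 q.2 ∂(π : Measure (X × X)) :=
        lintegral_const_mul' _ _ ENNReal.coe_ne_top
    _ ≤ L * (W1P a b + ε / (L + 1)) := by gcongr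
    _ ≤ L * W1P a b + (L + 1) * (ε / (L + 1)) := by
        rw [mul_add]; gcongr; exact le_self_add
    _ = L * W1P a b + ε := by
        rw [ENNReal.mul_div_cancel (by simp) (by simp)]

/-- The Wasserstein distance is lower semicontinuous along weakly convergent ultrafilters. -/
lemma W1P_le_of_tendsto [MetricSpace X] [BorelSpace X] [CompactSpace X]
    {𝒰 : Ultrafilter ℕ} (h𝒰 : (𝒰 : Filter ℕ) ≤ atTop)
    {as bs : ℕ → ProbabilityMeasure X} {a b : ProbabilityMeasure X} {w : ℝ≥0∞}
    (ha : Tendsto as 𝒰 (𝓝 a)) (hb : Tendsto bs 𝒰 (𝓝 b))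
    (hw : Tendsto (fun j => W1P (as j) (bs j)) 𝒰 (𝓝 w)) : W1P a b ≤ w := by
  have hex (j : ℕ) := exists_coupling_lintegral_le (as j) (bs j)
    (ε := (j : ℝ≥0∞)⁻¹) (ENNReal.inv_ne_zero.2 (ENNReal.natCast_ne_top j))
  choose π hπ hle using hex
  obtain ⟨ϖ, hϖ⟩ : ∃ ϖ, Tendsto π 𝒰 (𝓝 ϖ) := ⟨_, (𝒰.map π).le_nhds_lim⟩
  have hfst : ϖ.map (f := Prod.fst) measurable_fst.aemeasurable = a := by
    refine tendsto_nhds_unique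
      (((ProbabilityMeasure.continuous_map continuous_fst).tendsto ϖ).comp hϖ) ?_
    convert ha using 1
    ext1 j
    exact Subtype.ext (hπ j).1
  have hsnd : ϖ.map (f := Prod.snd) measurable_snd.aemeasurable = b := by
    refine tendsto_nhds_unique
      (((ProbabilityMeasure.continuous_map continuous_snd).tendsto ϖ).comp hϖ) ?_
    convert hb using 1
    ext1 j
    exact Subtype.ext (hπ j).2
  have hcoup : IsCoupling (a : Measure X) b ϖ :=
    ⟨congrArg Subtype.val hfst, congrArg Subtype.val hsnd⟩
  have hcost : Tendsto (fun j => ∫⁻ q, edist q.1 q.2 ∂(π j : Measure (X × X))) 𝒰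
      (𝓝 (∫⁻ q, edist q.1 q.2 ∂(ϖ : Measure (X × X)))) := by
    have := ((ProbabilityMeasure.continuous_lintegral_continuousMap
      (⟨fun q => nndist q.1 q.2, by fun_prop⟩ : C(X × X, ℝ≥0))).tendsto ϖ).comp hϖ
    simpa only [Function.comp_def, ContinuousMap.coe_mk, ← edist_nndist] using this
  refine (iInf₂_le (ϖ : Measure (X × X)) hcoup).trans ?_
  have hinv : Tendsto (fun j : ℕ => (j : ℝ≥0∞)⁻¹) 𝒰 (𝓝 0) :=
    ENNReal.tendsto_inv_nat_nhds_zero.mono_left h𝒰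
  refine le_of_tendsto_of_tendsto hcost ?_ (Eventually.of_forall hle)
  simpa using hw.add hinv

end Wasserstein

section Variation

variable {Z : Type*} {d : Z → Z → ℝ≥0∞} {f : ℝ → Z} {s s' : Set ℝ}

lemma varOn_mono_set (h : s ⊆ s') : varOn d f s ≤ varOn d f s' :=
  iSup_le fun p => le_iSup_of_le
    (⟨p.1, p.2.1, p.2.2.1, fun i => h (p.2.2.2 i)⟩ : ℕ × {u : ℕ → ℝ // Monotone u ∧ ∀ i, u i ∈ s'})
    le_rfl

lemma sum_le_varOn (N : ℕ) {u : ℕ → ℝ} (hu : Monotone u) (hus : ∀ i, u i ∈ s) :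
    ∑ i ∈ Finset.range N, d (f (u (i + 1))) (f (u i)) ≤ varOn d f s :=
  le_iSup_of_le (⟨N, u, hu, hus⟩ : ℕ × {u : ℕ → ℝ // Monotone u ∧ ∀ i, u i ∈ s}) le_rfl

/-- A chain in `s ∩ Iic x` can be prolonged by the two points `x ≤ y`. -/
lemma add_varOn_inter_Iic_le {x y : ℝ} (hx : x ∈ s) (hy : y ∈ s) (hxy : x ≤ y) :
    d (f y) (f x) + varOn d f (s ∩ Iic x) ≤ varOn d f (s ∩ Iic y) := by
  have : Nonempty (ℕ × {u : ℕ → ℝ // Monotone u ∧ ∀ i, u i ∈ s ∩ Iic x}) :=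
    ⟨0, fun _ => x, monotone_const, fun _ => ⟨hx, le_refl x⟩⟩
  conv_lhs => unfold varOn
  rw [ENNReal.add_iSup]
  refine iSup_le ?_
  rintro ⟨N, u, hu, hus⟩
  let v : ℕ → ℝ := fun i => if i ≤ N then u i else if i = N + 1 then x else y
  have hv : Monotone v := by
    refine monotone_nat_of_le_succ fun i => ?_
    have h1 : u i ≤ u (i + 1) := hu i.le_succ
    have h2 : u i ≤ x := (hus i).2
    simp only [v]
    split_ifs <;> first | omega | linarith
  have hvs (i : ℕ) : v i ∈ s ∩ Iic y := by
    have h2 : u i ≤ y := (hus i).2.trans hxy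
    simp only [v]
    split_ifs
    · exact ⟨(hus i).1, h2⟩
    · exact ⟨hx, hxy⟩
    · exact ⟨hy, le_refl y⟩
  refine le_trans ?_ (sum_le_varOn (N + 2) hv hvs)
  rw [Finset.sum_range_succ, Finset.sum_range_succ, add_comm]
  gcongr ?_ + ?_
  · refine le_add_of_le_of_nonneg (Finset.sum_le_sum fun i hi => ?_) zero_le
    have : i < N := Finset.mem_range.1 hi
    simp [v, this.le, Nat.succ_le_of_lt this]
  · simp [v]

lemma dist_le_varOn {x y : ℝ} (hx : x ∈ s) (hy : y ∈ s) (hxy : x ≤ y) :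
    d (f y) (f x) ≤ varOn d f s :=
  (le_self_add.trans (add_varOn_inter_Iic_le hx hy hxy)).trans
    (varOn_mono_set inter_subset_left)

lemma essVar_le_varOn {g : ℝ → Z} (h : ∀ᵐ t ∂lebI, g t = f t) :
    essVar d f ≤ varOn d g unitI :=
  iInf₂_le g h

end Variation

section Compactness

variable {X : Type*} [MeasurableSpace X] [MetricSpace X] [BorelSpace X] [CompactSpace X]

lemma varOn_W1P_le_of_tendsto {𝒰 : Ultrafilter ℕ} (h𝒰 : (𝒰 : Filter ℕ) ≤ atTop)
    {σs : ℕ → ℝ → ProbabilityMeasure X} {σ : ℝ → ProbabilityMeasure X} {s : Set ℝ}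
    (hσ : ∀ t, Tendsto (fun j => σs j t) 𝒰 (𝓝 (σ t))) {vs : ℕ → ℝ≥0∞} {v : ℝ≥0∞}
    (hle : ∀ j, varOn W1P (σs j) s ≤ vs j) (hv : Tendsto vs 𝒰 (𝓝 v)) :
    varOn W1P σ s ≤ v := by
  refine iSup_le ?_
  rintro ⟨N, u, hu, hus⟩
  have hex (i : ℕ) : ∃ w, Tendsto (fun j => W1P (σs j (u (i + 1))) (σs j (u i))) 𝒰 (𝓝 w) :=
    ⟨_, (𝒰.map fun j => W1P (σs j (u (i + 1))) (σs j (u i))).le_nhds_lim⟩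
  choose w hw using hex
  calc ∑ i ∈ Finset.range N, W1P (σ (u (i + 1))) (σ (u i))
      ≤ ∑ i ∈ Finset.range N, w i :=
        Finset.sum_le_sum fun i _ => W1P_le_of_tendsto h𝒰 (hσ _) (hσ _) (hw i)
    _ ≤ v := le_of_tendsto_of_tendsto (tendsto_finsetSum _ fun i _ => hw i) hv
        (Eventually.of_forall fun j => (sum_le_varOn N hu hus).trans (hle j))

lemma exists_rat_gt_of_eventually {P : ℝ → Prop} {t b : ℝ} (htb : t < b)
    (h : ∀ᶠ x in 𝓝 t, P x) : ∃ q : ℚ, t < q ∧ q < b ∧ P q := by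
  obtain ⟨l, hl, hP⟩ := exists_Ico_subset_of_mem_nhds h ⟨b, htb⟩
  obtain ⟨q, hq1, hq2⟩ := exists_rat_btwn (lt_min hl htb)
  exact ⟨q, hq1, hq2.trans_le (min_le_right _ _), hP ⟨hq1.le, hq2.trans_le (min_le_left _ _)⟩⟩

lemma exists_rat_lt_of_eventually {P : ℝ → Prop} {t b : ℝ} (htb : b < t)
    (h : ∀ᶠ x in 𝓝 t, P x) : ∃ q : ℚ, b < q ∧ q < t ∧ P q := by
  obtain ⟨l, hl, hP⟩ := exists_Ioc_subset_of_mem_nhds h ⟨b, htb⟩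
  obtain ⟨q, hq1, hq2⟩ := exists_rat_btwn (max_lt hl htb)
  exact ⟨q, (le_max_right _ _).trans_lt hq1, hq2, hP ⟨(le_max_left _ _).trans_lt hq1, hq2.le⟩⟩

/-- **Helly's selection principle** for curves of probability measures. -/
theorem exists_subseq_tendsto_ae_of_varOn_le {σs : ℕ → ℝ → ProbabilityMeasure X}
    {vs : ℕ → ℝ≥0∞} {v : ℝ≥0∞} (hle : ∀ j, varOn W1P (σs j) unitI ≤ vs j)
    (hv : Tendsto vs atTop (𝓝 v)) (hvtop : v ≠ ⊤) :
    ∃ (σ : ℝ → ProbabilityMeasure X) (φ : ℕ → ℕ), StrictMono φ ∧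
      varOn W1P σ unitI ≤ v ∧ ∀ᵐ t ∂lebI, Tendsto (fun j => σs (φ j) t) atTop (𝓝 (σ t)) := by
  let 𝒰 : Ultrafilter ℕ := Ultrafilter.of atTop
  have h𝒰 : (𝒰 : Filter ℕ) ≤ atTop := Ultrafilter.of_le _
  let V (j : ℕ) (t : ℝ) : ℝ≥0∞ := varOn W1P (σs j) (unitI ∩ Iic t)
  have hex (t : ℝ) : ∃ p, Tendsto (fun j => (σs j t, V j t)) 𝒰 (𝓝 p) :=
    ⟨_, (𝒰.map fun j => (σs j t, V j t)).le_nhds_lim⟩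
  choose p hp using hex
  let σ (t : ℝ) := (p t).1
  let W (t : ℝ) := (p t).2
  have hσ (t : ℝ) : Tendsto (fun j => σs j t) 𝒰 (𝓝 (σ t)) := (hp t).fst_nhds
  have hW (t : ℝ) : Tendsto (fun j => V j t) 𝒰 (𝓝 (W t)) := (hp t).snd_nhds
  have hVmono (j : ℕ) : Monotone (V j) := fun a b hab =>
    varOn_mono_set (inter_subset_inter_right _ (Iic_subset_Iic.2 hab))
  have hWmono : Monotone W := fun a b hab =>
    le_of_tendsto_of_tendsto' (hW a) (hW b) fun j => hVmono j hab
  have hWtop (t : ℝ) : W t ≠ ⊤ := ne_top_of_le_ne_top hvtop <|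
    le_of_tendsto_of_tendsto' (hW t) (hv.mono_left h𝒰) fun j =>
      (varOn_mono_set inter_subset_left).trans (hle j)
  have hVadd (j : ℕ) {a b : ℝ} (ha : a ∈ unitI) (hb : b ∈ unitI) (hab : a ≤ b) :
      W1P (σs j b) (σs j a) + V j a ≤ V j b := add_varOn_inter_Iic_le ha hb hab
  have hWadd {a b : ℝ} (ha : a ∈ unitI) (hb : b ∈ unitI) (hab : a ≤ b) :
      W1P (σ b) (σ a) + W a ≤ W b := by
    obtain ⟨w, hw⟩ : ∃ w, Tendsto (fun j => W1P (σs j b) (σs j a)) 𝒰 (𝓝 w) :=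
      ⟨_, (𝒰.map fun j => W1P (σs j b) (σs j a)).le_nhds_lim⟩
    calc W1P (σ b) (σ a) + W a ≤ w + W a := by
          gcongr; exact W1P_le_of_tendsto h𝒰 (hσ b) (hσ a) hw
      _ ≤ W b := le_of_tendsto_of_tendsto' (hw.add (hW a)) (hW b) fun j => hVadd j ha hb hab
  obtain ⟨φ, hφ, hlim⟩ : ∃ φ : ℕ → ℕ, StrictMono φ ∧
      Tendsto ((fun j (q : ℚ) => (σs j q, V j q)) ∘ φ) atTop (𝓝 fun q : ℚ => p q) := by
    have h : Tendsto (fun j (q : ℚ) => (σs j q, V j q)) 𝒰 (𝓝 fun q : ℚ => p q) :=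
      tendsto_pi_nhds.2 fun q => hp q
    exact (h.mapClusterPt.mono h𝒰).tendsto_subseq
  have hlimq (q : ℚ) : Tendsto (fun j => (σs (φ j) q, V (φ j) q)) atTop (𝓝 (p q)) :=
    tendsto_pi_nhds.1 hlim q
  refine ⟨σ, φ, hφ, varOn_W1P_le_of_tendsto h𝒰 hσ hle (hv.mono_left h𝒰), ?_⟩
  have hcont : ∀ᵐ t ∂lebI, ContinuousAt W t :=
    ae_restrict_of_ae (hWmono.countable_not_continuousAt.ae_notMem volume |>.mono
      fun t ht => not_not.1 ht)
  have hIoo : ∀ᵐ t ∂lebI, t ∈ Ioo (0 : ℝ) 1 := by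
    rw [lebI, unitI, ← restrict_Ioo_eq_restrict_Icc]
    exact ae_restrict_mem measurableSet_Ioo
  filter_upwards [hcont, hIoo] with t ht htI
  rw [tendsto_iff_forall_lipschitz_integral_tendsto]
  rintro f - ⟨L, hL⟩
  rw [tendsto_iff_edist_tendsto_0, ENNReal.tendsto_nhds_zero]
  intro ε hε
  have hosc : Tendsto (fun x : ℝ × ℝ => L * (W x.1 - W x.2) + L * (W x.1 - W x.2))
      (𝓝 t ×ˢ 𝓝 t) (𝓝 0) := by
    have h : Tendsto (fun x : ℝ × ℝ => L * (W x.1 - W x.2)) (𝓝 t ×ˢ 𝓝 t)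
        (𝓝 (L * (W t - W t))) :=
      ENNReal.Tendsto.const_mul (ENNReal.Tendsto.sub (ht.tendsto.comp tendsto_fst)
        (ht.tendsto.comp tendsto_snd) (.inl (hWtop t))) (.inr ENNReal.coe_ne_top)
    simpa using h.add h
  obtain ⟨A, hA, B, hB, hAB⟩ := eventually_prod_iff.1 (hosc.eventually_lt_const hε)
  obtain ⟨q, htq, hq1, hAq⟩ := exists_rat_gt_of_eventually htI.2 hA
  obtain ⟨r, hr0, hrt, hBr⟩ := exists_rat_lt_of_eventually htI.1 hB
  have hqI : (q : ℝ) ∈ unitI := ⟨(htI.1.trans htq).le, hq1.le⟩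
  have htI' : t ∈ unitI := ⟨htI.1.le, htI.2.le⟩
  have hbound : Tendsto (fun j => L * (V (φ j) q - V (φ j) r)
      + edist (∫ x, f x ∂(σs (φ j) q : Measure X)) (∫ x, f x ∂(σ q : Measure X))
      + L * (W q - W r)) atTop (𝓝 (L * (W q - W r) + 0 + L * (W q - W r))) := by
    refine Tendsto.add (Tendsto.add ?_ ?_) tendsto_const_nhds
    · exact ENNReal.Tendsto.const_mul (ENNReal.Tendsto.sub (hlimq q).snd_nhds
        (hlimq r).snd_nhds (.inl (hWtop q))) (.inr ENNReal.coe_ne_top)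
    · rw [← tendsto_iff_edist_tendsto_0]
      exact ((ProbabilityMeasure.continuous_integral_continuousMap
        (⟨f, hL.continuous⟩ : C(X, ℝ))).tendsto (σ q)).comp (hlimq q).fst_nhds
  rw [add_zero] at hbound
  filter_upwards [hbound.eventually_lt_const (hAB hAq hBr),
    (hlimq r).snd_nhds.eventually_ne (hWtop r)] with j hj hVr
  refine le_trans ?_ hj.le
  have hfirst : W1P (σs (φ j) q) (σs (φ j) t) ≤ V (φ j) q - V (φ j) r :=
    ENNReal.le_sub_of_add_le_right hVr
      ((add_le_add_right (hVmono (φ j) hrt.le) _).trans (hVadd (φ j) htI' hqI htq.le))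
  have hlast : W1P (σ q) (σ t) ≤ W q - W r :=
    ENNReal.le_sub_of_add_le_right (hWtop r)
      ((add_le_add_right (hWmono hrt.le) _).trans (hWadd htI' hqI htq.le))
  calc edist (∫ x, f x ∂(σs (φ j) t : Measure X)) (∫ x, f x ∂(σ t : Measure X))
      ≤ edist (∫ x, f x ∂(σs (φ j) t : Measure X)) (∫ x, f x ∂(σs (φ j) q : Measure X))
        + edist (∫ x, f x ∂(σs (φ j) q : Measure X)) (∫ x, f x ∂(σ q : Measure X))
        + edist (∫ x, f x ∂(σ q : Measure X)) (∫ x, f x ∂(σ t : Measure X)) :=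
        edist_triangle4 _ _ _ _
    _ ≤ _ := by
        gcongr
        · rw [edist_comm]
          exact (edist_integral_le_W1P hL _ _).trans (by gcongr)
        · exact (edist_integral_le_W1P hL _ _).trans (by gcongr)

end Compactness

section Admissible

lemma W1_self {X : Type*} [MeasurableSpace X] [MetricSpace X] [BorelSpace X]
    [SecondCountableTopology X] (a : Measure X) : W1 a a = 0 := by
  have hdiag : Measurable fun x : X => (x, x) := measurable_id.prodMk measurable_id
  have hcoup : IsCoupling a a (a.map fun x => (x, x)) := by
    constructor
    · rw [Measure.map_map measurable_fst hdiag]; exact Measure.map_id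
    · rw [Measure.map_map measurable_snd hdiag]; exact Measure.map_id
  refine le_antisymm ((iInf₂_le _ hcoup).trans ?_) zero_le
  rw [lintegral_map (by fun_prop) hdiag]
  simp

section Scaling

variable {X : Type*} [MeasurableSpace X] [PseudoEMetricSpace X]

lemma varOn_W1M_smul_le {c : ℝ≥0∞} (hc : c ≠ ⊤) (σ : ℝ → ProbabilityMeasure X) (s : Set ℝ) :
    varOn W1M (fun t => c • (σ t : Measure X)) s ≤ c * varOn W1P σ s := by
  refine iSup_le ?_
  rintro ⟨N, u, hu, hus⟩
  calc ∑ i ∈ Finset.range N, W1M (c • (σ (u (i + 1)) : Measure X)) (c • (σ (u i) : Measure X))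
      ≤ ∑ i ∈ Finset.range N, c * W1P (σ (u (i + 1))) (σ (u i)) :=
        Finset.sum_le_sum fun i _ => W1_smul_le hc _ _
    _ = c * ∑ i ∈ Finset.range N, W1P (σ (u (i + 1))) (σ (u i)) := by rw [Finset.mul_sum]
    _ ≤ c * varOn W1P σ s := by gcongr; exact sum_le_varOn N hu hus

lemma exists_ae_eq_varOn_lt {Z : Type*} {d : Z → Z → ℝ≥0∞} {f : ℝ → Z} {r : ℝ≥0∞}
    (h : essVar d f < r) :
    ∃ g : ℝ → Z, (∀ᵐ t ∂lebI, g t = f t) ∧ varOn d g unitI < r := by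
  simp only [essVar, essVarOn, iInf_lt_iff] at h
  obtain ⟨g, hg, hlt⟩ := h
  exact ⟨g, hg, hlt⟩

lemma essVar_W1M_smul_lt_top {c : ℝ≥0∞} (hc : c ≠ ⊤) {ρ : ℝ → ProbabilityMeasure X}
    (hρ : essVar W1P ρ < ⊤) : essVar W1M (fun t => c • (ρ t : Measure X)) < ⊤ := by
  obtain ⟨g, hg, hlt⟩ := exists_ae_eq_varOn_lt hρ
  refine (essVar_le_varOn (g := fun t => c • (g t : Measure X)) ?_).trans_lt
    ((varOn_W1M_smul_le hc g unitI).trans_lt (ENNReal.mul_lt_top hc.lt_top hlt))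
  filter_upwards [hg] with t ht
  rw [ht]

/-- A representative of small variation of a weighted curve of probability measures is, after
normalization, again a curve of probability measures. -/
lemma exists_probability_representative {c : ℝ≥0∞} (hc : c ≠ ⊤)
    (ρ : ℝ → ProbabilityMeasure X) {r : ℝ≥0∞}
    (h : essVar W1M (fun t => c • (ρ t : Measure X)) < r) :
    ∃ σ : ℝ → ProbabilityMeasure X,
      (∀ᵐ t ∂lebI, c • (σ t : Measure X) = c • (ρ t : Measure X)) ∧
      varOn W1P σ unitI ≤ c⁻¹ * r := by
  rcases eq_or_ne c 0 with rfl | hc0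
  · exact ⟨ρ, by simp, by simp [ENNReal.top_mul h.ne_bot]⟩
  obtain ⟨g, hg, hlt⟩ := exists_ae_eq_varOn_lt h
  have : (ae lebI).NeBot := by
    rw [ae_neBot, lebI, unitI, Ne, Measure.restrict_eq_zero]
    simp
  have hmem : ∀ᵐ t ∂lebI, t ∈ unitI := ae_restrict_mem measurableSet_Icc
  obtain ⟨t₀, ht₀, ht₀I⟩ := (hg.and hmem).exists
  have hmass {t : ℝ} (ht : t ∈ unitI) : g t univ = c := by
    have h₀ : g t₀ univ = c := by rw [ht₀]; simp
    rcases le_total t t₀ with hle | hle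
    · rw [← h₀]
      exact (measure_univ_eq_of_W1_ne_top
        ((dist_le_varOn (d := W1M) ht ht₀I hle).trans_lt hlt).ne_top).symm
    · rw [← h₀]
      exact measure_univ_eq_of_W1_ne_top
        ((dist_le_varOn (d := W1M) ht₀I ht hle).trans_lt hlt).ne_top
  classical
  let σ (t : ℝ) : ProbabilityMeasure X :=
    if ht : t ∈ unitI then ⟨c⁻¹ • g t, ⟨by simp [hmass ht, ENNReal.inv_mul_cancel hc0 hc]⟩⟩
    else ρ t
  have hσ {t : ℝ} (ht : t ∈ unitI) : (σ t : Measure X) = c⁻¹ • g t := by simp [σ, ht]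
  refine ⟨σ, ?_, ?_⟩
  · filter_upwards [hg, hmem] with t ht htI
    rw [hσ htI, smul_smul, ENNReal.mul_inv_cancel hc0 hc, one_smul, ht]
  · refine iSup_le ?_
    rintro ⟨N, u, hu, hus⟩
    calc ∑ i ∈ Finset.range N, W1P (σ (u (i + 1))) (σ (u i))
        ≤ ∑ i ∈ Finset.range N, c⁻¹ * W1M (g (u (i + 1))) (g (u i)) := by
          refine Finset.sum_le_sum fun i _ => ?_
          rw [W1P, hσ (hus _), hσ (hus _)]
          exact W1_smul_le (ENNReal.inv_ne_top.2 hc0) _ _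
      _ = c⁻¹ * ∑ i ∈ Finset.range N, W1M (g (u (i + 1))) (g (u i)) := by rw [Finset.mul_sum]
      _ ≤ c⁻¹ * r := by gcongr; exact (sum_le_varOn N hu hus).trans hlt.le

end Scaling

variable {n : ℕ} {Ω : Set (EuclideanSpace ℝ (Fin n))}

lemma zero_mem_Adm (hΩ : Ω.Nonempty) : (fun _ => 0) ∈ Adm Ω := by
  obtain ⟨x, hx⟩ := hΩ
  refine ⟨0, fun _ => ⟨Measure.dirac (⟨x, hx⟩ : Ω), inferInstance⟩, ?_, fun t => by simp⟩
  refine (essVar_le_varOn (Eventually.of_forall fun _ => rfl)).trans_lt ?_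
  simp [varOn, W1P, W1_self]

lemma essVar_W1M_lt_top {μ : ℝ → Measure ↥Ω} (hμ : μ ∈ Adm Ω) : essVar W1M μ < ⊤ := by
  obtain ⟨c, ρ, hρ, h⟩ := hμ
  rw [funext h]
  exact essVar_W1M_smul_lt_top ENNReal.coe_ne_top hρ

lemma measure_univ_lt_top {μ : ℝ → Measure ↥Ω} (hμ : μ ∈ Adm Ω) (t : ℝ) : μ t univ < ⊤ := by
  obtain ⟨c, ρ, hρ, h⟩ := hμ
  simp [h]

lemma essVar_W1M_zero : essVar W1M (fun _ => (0 : Measure ↥Ω)) = 0 := by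
  refine le_antisymm ((essVar_le_varOn (Eventually.of_forall fun _ => rfl)).trans ?_) zero_le
  simp [varOn, W1M, W1_self]

/-- Sequences of admissible curves with convergent weights and variations are compact with
respect to almost everywhere weak-* convergence. -/
theorem exists_subseq_aeWStar (hΩne : Ω.Nonempty) (hΩ : IsCompact Ω)
    {μs : ℕ → ℝ → Measure ↥Ω} (hμs : ∀ j, μs j ∈ Adm Ω) {c r : ℝ≥0∞}
    (hc : Tendsto (fun j => μs j 0 univ) atTop (𝓝 c)) (hctop : c ≠ ⊤)
    (hr : Tendsto (fun j => essVar W1M (μs j)) atTop (𝓝 r)) (hrtop : r ≠ ⊤) :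
    ∃ μ ∈ Adm Ω, ∃ φ : ℕ → ℕ, StrictMono φ ∧ AEWStar (fun j => μs (φ j)) μ ∧
      μ 0 univ = c ∧ essVar W1M μ ≤ r := by
  have : CompactSpace Ω := isCompact_iff_compactSpace.1 hΩ
  have hmem := hμs
  choose w ρ hρ hμ using hmem
  have hw (j : ℕ) : μs j 0 univ = w j := by simp [hμ]
  have hw' : Tendsto (fun j => (w j : ℝ≥0∞)) atTop (𝓝 c) := by simpa only [hw] using hc
  have hwR : Tendsto (fun j => (w j : ℝ)) atTop (𝓝 c.toReal) :=
    (ENNReal.tendsto_toReal hctop).comp hw'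
  rcases eq_or_ne c 0 with rfl | hc0
  · refine ⟨_, zero_mem_Adm hΩne, id, strictMono_id, ae_of_all _ fun t f => ?_, by simp,
      by simp [essVar_W1M_zero]⟩
    rw [integral_zero_measure]
    refine squeeze_zero_norm (a := fun j => ‖f‖ * w j) (fun j => ?_)
      (by simpa using hwR.const_mul ‖f‖)
    change ‖∫ x, f x ∂(μs j t)‖ ≤ ‖f‖ * w j
    have : IsFiniteMeasure (μs j t) := ⟨measure_univ_lt_top (hμs j) t⟩
    refine (norm_integral_le_of_norm_le_const (ae_of_all _ f.norm_coe_le_norm)).trans_eq ?_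
    simp [Measure.real, hμ]
  · have hex (j : ℕ) := exists_probability_representative (c := w j) ENNReal.coe_ne_top (ρ j)
      (r := essVar W1M (μs j) + (j : ℝ≥0∞)⁻¹) (by
        rw [← funext (hμ j)]
        exact ENNReal.lt_add_right (essVar_W1M_lt_top (hμs j)).ne
          (ENNReal.inv_ne_zero.2 (ENNReal.natCast_ne_top j)))
    choose σs hσs hvar using hex
    have hlim : Tendsto (fun j => (w j : ℝ≥0∞)⁻¹ * (essVar W1M (μs j) + (j : ℝ≥0∞)⁻¹)) atTop
        (𝓝 (c⁻¹ * (r + 0))) :=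
      ENNReal.Tendsto.mul (tendsto_inv_iff.2 hw') (.inr (by simpa using hrtop))
        (hr.add ENNReal.tendsto_inv_nat_nhds_zero) (.inr (ENNReal.inv_ne_top.2 hc0))
    rw [add_zero] at hlim
    have hvtop : c⁻¹ * r ≠ ⊤ := ENNReal.mul_ne_top (ENNReal.inv_ne_top.2 hc0) hrtop
    obtain ⟨σ, φ, hφ, hσ, hconv⟩ := exists_subseq_tendsto_ae_of_varOn_le hvar hlim hvtop
    refine ⟨fun t => c • (σ t : Measure Ω), ⟨c.toNNReal, σ, ?_, ?_⟩, φ, hφ, ?_, by simp, ?_⟩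
    · exact (essVar_le_varOn (Eventually.of_forall fun _ => rfl)).trans_lt
        (hσ.trans_lt hvtop.lt_top)
    · simp [ENNReal.coe_toNNReal hctop]
    · filter_upwards [hconv, ae_all_iff.2 hσs] with t ht hrep f
      have hf := ((ProbabilityMeasure.continuous_integral_continuousMap f).tendsto (σ t)).comp ht
      have := (hwR.comp hφ.tendsto_atTop).mul hf
      simpa [hμ, ← hrep, NNReal.smul_def, Function.comp_def] using this
    · refine (essVar_le_varOn (Eventually.of_forall fun _ => rfl)).trans
        ((varOn_W1M_smul_le hctop σ unitI).trans ?_)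
      calc c * varOn W1P σ unitI ≤ c * (c⁻¹ * r) := by gcongr
        _ = r := by rw [← mul_assoc, ENNReal.mul_inv_cancel hc0 hctop, one_mul]

end Admissible

/-- Existence for the BV curve tracking problem.
The infimum over `μ ∈ 𝒜` of `𝓕(K(μ)) + 𝓡_{α,β}(μ)` is attained. -/
theorem bv_curve_tracking_exists_solution
    {n : ℕ} (Ω : Set (EuclideanSpace ℝ (Fin n)))
    (hΩne : Ω.Nonempty) (hΩcp : IsCompact Ω) (hΩcv : Convex ℝ Ω)
    {Y : Type*} [NormedAddCommGroup Y] [InnerProductSpace ℝ Y] [CompleteSpace Y]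
    (F : Y → EReal)
    (hFbdd : ∃ B : ℝ, ∀ y : Y, (B : EReal) ≤ F y)
    (hFproper : ∃ y : Y, F y ≠ ⊤)
    (hFlsc : ∀ (ys : ℕ → Y) (y : Y), WeakTendsto ys y →
      F y ≤ Filter.liminf (fun j => F (ys j)) Filter.atTop)
    (K : (ℝ → Measure ↥Ω) → Y)
    (hK : ∀ (μs : ℕ → (ℝ → Measure ↥Ω)) (μ : ℝ → Measure ↥Ω),
      (∀ j, μs j ∈ Adm Ω) → μ ∈ Adm Ω → AEWStar μs μ →
      WeakTendsto (fun j => K (μs j)) (K μ))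
    (α β : ℝ) (hα : 0 < α) (hβ : 0 < β) :
    ∃ μ ∈ Adm Ω, ∀ ν ∈ Adm Ω,
      F (K μ) + (Reg α β μ : EReal) ≤ F (K ν) + (Reg α β ν : EReal) := by
  let J (ν : ℝ → Measure ↥Ω) : EReal := F (K ν) + (Reg α β ν : EReal)
  change ∃ μ ∈ Adm Ω, ∀ ν ∈ Adm Ω, J μ ≤ J ν
  by_cases htop : ∀ ν ∈ Adm Ω, J ν = ⊤
  · exact ⟨_, zero_mem_Adm hΩne, fun ν hν => (htop ν hν).symm ▸ le_top⟩
  push Not at htop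
  obtain ⟨ν₀, hν₀, hJν₀⟩ := htop
  obtain ⟨B, hB⟩ := hFbdd
  obtain ⟨u, -, hu, huS⟩ := exists_seq_tendsto_sInf (S := J '' Adm Ω) ⟨_, ν₀, hν₀, rfl⟩
    (OrderBot.bddBelow _)
  choose ν hν hJν using huS
  have hlt : sInf (J '' Adm Ω) < ⊤ :=
    (sInf_le (mem_image_of_mem J hν₀)).trans_lt (lt_top_iff_ne_top.2 hJν₀)
  obtain ⟨M, hM, -⟩ := EReal.lt_iff_exists_real_btwn.1 hlt
  obtain ⟨N, hN⟩ := eventually_atTop.1 (hu.eventually_lt_const hM)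
  obtain ⟨⟨c, r, f⟩, φ, hφ, hlim⟩ := CompactSpace.tendsto_subseq fun j =>
    (ν (j + N) 0 univ, essVar W1M (ν (j + N)), F (K (ν (j + N))))
  let μs (j : ℕ) := ν (φ j + N)
  have hμs (j : ℕ) : μs j ∈ Adm Ω := hν _
  have hReg (j : ℕ) : Reg α β (μs j) ≤ M - B := by
    have h : (B : EReal) + (Reg α β (μs j) : EReal) ≤ M :=
      (add_le_add_left (hB (K (μs j))) _).trans ((hJν _).trans_le (hN _ (by omega)).le)
    have h' : B + Reg α β (μs j) ≤ M := by exact_mod_cast h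
    linarith
  have hc : Tendsto (fun j => μs j 0 univ) atTop (𝓝 c) := hlim.fst_nhds
  have hr : Tendsto (fun j => essVar W1M (μs j)) atTop (𝓝 r) := hlim.snd_nhds.fst_nhds
  have hf : Tendsto (fun j => F (K (μs j))) atTop (𝓝 f) := hlim.snd_nhds.snd_nhds
  have hctop : c ≠ ⊤ := by
    refine ne_top_of_le_ne_top ENNReal.ofReal_ne_top
      (le_of_tendsto' hc fun j => ?_ : c ≤ ENNReal.ofReal ((M - B) / α))
    rw [← ENNReal.ofReal_toReal (measure_univ_lt_top (hμs j) 0).ne]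
    refine ENNReal.ofReal_le_ofReal ((le_div_iff₀' hα).2 ?_)
    have h := hReg j
    have : 0 ≤ β * (essVar W1M (μs j)).toReal := by positivity
    rw [Reg, wt] at h
    linarith
  have hrtop : r ≠ ⊤ := by
    refine ne_top_of_le_ne_top ENNReal.ofReal_ne_top
      (le_of_tendsto' hr fun j => ?_ : r ≤ ENNReal.ofReal ((M - B) / β))
    rw [← ENNReal.ofReal_toReal (essVar_W1M_lt_top (hμs j)).ne]
    refine ENNReal.ofReal_le_ofReal ((le_div_iff₀' hβ).2 ?_)
    have h := hReg j
    have : 0 ≤ α * (μs j 0 univ).toReal := by positivity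
    rw [Reg, wt] at h
    linarith
  obtain ⟨μ, hμ, ψ, hψ, hconv, hμc, hμr⟩ := exists_subseq_aeWStar hΩne hΩcp hμs hc hctop hr hrtop
  refine ⟨μ, hμ, fun ν' hν' => ?_⟩
  have hF : F (K μ) ≤ f :=
    (hFlsc _ _ (hK _ μ (fun j => hμs (ψ j)) hμ hconv)).trans_eq
      (hf.comp hψ.tendsto_atTop).liminf_eq
  have hRegμ : Reg α β μ ≤ α * c.toReal + β * r.toReal := by
    rw [Reg, wt, hμc]
    gcongr
  have hReglim : Tendsto (fun j => Reg α β (μs j)) atTop (𝓝 (α * c.toReal + β * r.toReal)) :=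
    (((ENNReal.tendsto_toReal hctop).comp hc).const_mul α).add
      (((ENNReal.tendsto_toReal hrtop).comp hr).const_mul β)
  have hJlim : Tendsto (fun j => J (μs j)) atTop
      (𝓝 (f + ((α * c.toReal + β * r.toReal : ℝ) : EReal))) :=
    (EReal.continuousAt_add (.inr (EReal.coe_ne_bot _)) (.inr (EReal.coe_ne_top _))).tendsto.comp
      (hf.prodMk_nhds ((continuous_coe_real_ereal.tendsto _).comp hReglim))
  have hJinf : Tendsto (fun j => J (μs j)) atTop (𝓝 (sInf (J '' Adm Ω))) := by
    simp only [μs, hJν]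
    exact ((tendsto_add_atTop_iff_nat N).2 hu).comp hφ.tendsto_atTop
  calc J μ ≤ f + ((α * c.toReal + β * r.toReal : ℝ) : EReal) :=
        add_le_add hF (EReal.coe_le_coe_iff.2 hRegμ)
    _ = sInf (J '' Adm Ω) := tendsto_nhds_unique hJlim hJinf
    _ ≤ J ν' := sInf_le (mem_image_of_mem J hν')

end
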